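/- arXiv:2006.03469 — 2 statements merged into one kernel-verified Lean document; each statement's English description precedes it below -/
import Mathlib

section
/- Let λ ≥ 0 and M ≥ 0. Let Q : ℝ³ → ℝ³ be a linear isometric equivalence with Q e₁ = e₁, and let x₀ ∈ ℝ³ with ‖x₀‖ ≤ M. For y ∈ ℝ³ set x := Q y + x₀, and set c := (1+M)(1+4λM). Then c⁻¹ (1+‖y‖)(1+2λ s(y)) ≤ (1+‖x‖)(1+2λ s(x)) ≤ c (1+‖y‖)(1+2λ s(y)), where s(z) := ‖z‖ + ⟨z, e₁⟩. -/
open scoped RealInnerProductSpace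

section Wake

variable {E : Type*} [NormedAddCommGroup E] [InnerProductSpace ℝ E]

lemma wake_nonneg {e : E} (he : ‖e‖ ≤ 1) (u : E) : 0 ≤ ‖u‖ + ⟪u, e⟫ := by
  have h := neg_le_of_abs_le (abs_real_inner_le_norm u e)
  nlinarith [norm_nonneg u]

lemma wake_add_le {e : E} (he : ‖e‖ ≤ 1) (u v : E) :
    ‖u + v‖ + ⟪u + v, e⟫ ≤ ‖u‖ + ⟪u, e⟫ + 2 * ‖v‖ := by
  have h := real_inner_le_norm v e
  rw [inner_add_left]
  nlinarith [norm_add_le u v, norm_nonneg v]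

lemma wake_weight_add_le {lam M : ℝ} (hlam : 0 ≤ lam) {e : E} (he : ‖e‖ ≤ 1) (u : E)
    {v : E} (hv : ‖v‖ ≤ M) :
    (1 + ‖u + v‖) * (1 + 2 * lam * (‖u + v‖ + ⟪u + v, e⟫)) ≤
      (1 + M) * (1 + 4 * lam * M) * ((1 + ‖u‖) * (1 + 2 * lam * (‖u‖ + ⟪u, e⟫))) := by
  have hM : 0 ≤ M := (norm_nonneg v).trans hv
  have hu := wake_nonneg he u
  have huv := wake_nonneg he (u + v)
  have hnorm : 1 + ‖u + v‖ ≤ (1 + M) * (1 + ‖u‖) := by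
    nlinarith [norm_add_le u v, mul_nonneg hM (norm_nonneg u)]
  have hwake : 1 + 2 * lam * (‖u + v‖ + ⟪u + v, e⟫) ≤
      (1 + 4 * lam * M) * (1 + 2 * lam * (‖u‖ + ⟪u, e⟫)) := by
    have hle : ‖u + v‖ + ⟪u + v, e⟫ ≤ ‖u‖ + ⟪u, e⟫ + 2 * M := by
      linarith [wake_add_le he u v]
    have hprod : 0 ≤ lam * M * (lam * (‖u‖ + ⟪u, e⟫)) := by positivity
    nlinarith [mul_le_mul_of_nonneg_left hle hlam]
  calc
    _ ≤ ((1 + M) * (1 + ‖u‖)) * ((1 + 4 * lam * M) * (1 + 2 * lam * (‖u‖ + ⟪u, e⟫))) :=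
      mul_le_mul hnorm hwake (by positivity) (by positivity)
    _ = _ := by ring

end Wake

/-- Equivalence of the anisotropic Oseen wake weights `(1+|x|)(1+2λ s(x))` under the change
of variables `x = Q y + x₀`, where `Q` is an isometry fixing `e₁` and `‖x₀‖ ≤ M`. -/
theorem stmt_2 (lam M : ℝ) (hlam : 0 ≤ lam) (hM : 0 ≤ M)
    (Q : EuclideanSpace ℝ (Fin 3) ≃ₗᵢ[ℝ] EuclideanSpace ℝ (Fin 3))
    (e₁ : EuclideanSpace ℝ (Fin 3)) (he₁ : e₁ = EuclideanSpace.single 0 1)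
    (hQ : Q e₁ = e₁)
    (x₀ : EuclideanSpace ℝ (Fin 3)) (hx₀ : ‖x₀‖ ≤ M)
    (s : EuclideanSpace ℝ (Fin 3) → ℝ) (hs : ∀ z, s z = ‖z‖ + ⟪z, e₁⟫)
    (y x : EuclideanSpace ℝ (Fin 3)) (hx : x = Q y + x₀)
    (c : ℝ) (hc : c = (1 + M) * (1 + 4 * lam * M)) :
    c⁻¹ * ((1 + ‖y‖) * (1 + 2 * lam * s y)) ≤ (1 + ‖x‖) * (1 + 2 * lam * s x) ∧
      (1 + ‖x‖) * (1 + 2 * lam * s x) ≤ c * ((1 + ‖y‖) * (1 + 2 * lam * s y)) := by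
  have he : ‖e₁‖ ≤ 1 := by simp [he₁]
  have hinner : ⟪Q y, e₁⟫ = ⟪y, e₁⟫ := by
    conv_lhs => rw [← hQ]
    exact Q.inner_map_map y e₁
  have hcpos : 0 < c := by rw [hc]; positivity
  have hupper := wake_weight_add_le hlam he (Q y) hx₀
  have hlower := wake_weight_add_le hlam he x ((norm_neg x₀).trans_le hx₀)
  have hback : x + -x₀ = Q y := by rw [hx, add_neg_cancel_right]
  rw [← hx, ← hc, hinner, Q.norm_map] at hupper
  rw [hback, ← hc, hinner, Q.norm_map] at hlower
  rw [hs, hs]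
  exact ⟨(inv_mul_le_iff₀ hcpos).2 hlower, hupper⟩
end

section
/- There exists a family of functions ψ_R : ℝ³ → ℝ, defined for all R > 0, and constants C₁, C₂ > 0 independent of R, such that for every R > 0: (i) ψ_R is infinitely differentiable with compact support and 0 ≤ ψ_R(x) ≤ 1 for all x; (ii) for every x ∈ ℝ³, ψ_R(x) → 1 as R → ∞; (iii) the L^{3/2}(ℝ³)-norm of the partial derivative ∂₁ψ_R := x ↦ (Dψ_R(x))(e₁) satisfies ‖∂₁ψ_R‖_{L^{3/2}} ≤ C₁; (iv) the support of the derivative Dψ_R is contained in {x : ‖x‖ ≥ R/√2}; and (v) for every continuously differentiable compactly supported u : ℝ³ → ℝ, ∫_{ℝ³} u(x)² ‖Dψ_R(x)‖² dx ≤ C₂² ∫_{‖x‖ ≥ R/√2} ‖Du(x)‖² dx. -/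
open MeasureTheory Filter

lemma sum_sq_single_eq_norm_sq (L : EuclideanSpace ℝ (Fin 3) →L[ℝ] ℝ) :
    ‖L‖ ^ 2 = ∑ i, L (EuclideanSpace.single i 1) ^ 2 := by
  set v := (InnerProductSpace.toDual ℝ (EuclideanSpace ℝ (Fin 3))).symm L with hv
  have hL : ∀ i, L (EuclideanSpace.single i 1) = v i := by
    intro i
    have := InnerProductSpace.toDual_symm_apply (𝕜 := ℝ) (x := EuclideanSpace.single i 1) (y := L)
    rw [← this, ← hv, EuclideanSpace.inner_single_right]
    simp
  have hn : ‖L‖ = ‖v‖ := by simp [hv]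
  rw [hn, EuclideanSpace.norm_sq_eq]
  simp [hL]

lemma integral_fderiv_apply_eq_zero {g : EuclideanSpace ℝ (Fin 3) → ℝ} (hg : ContDiff ℝ 1 g)
    (hc : HasCompactSupport g) (v : EuclideanSpace ℝ (Fin 3)) :
    ∫ x, fderiv ℝ g x v = 0 := by
  have h := integral_mul_fderiv_eq_neg_fderiv_mul_of_integrable (μ := volume)
    (f := fun _ : EuclideanSpace ℝ (Fin 3) => (1 : ℝ)) (g := g) (v := v) (by simp)
    (by
      simp only [one_mul]
      exact ((hg.continuous_fderiv one_ne_zero).clm_apply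
        continuous_const).integrable_of_hasCompactSupport (hc.fderiv_apply ℝ v))
    (by simpa using hg.continuous.integrable_of_hasCompactSupport hc)
    (by intros; fun_prop)
    (fun x _ => hg.differentiable one_ne_zero x)
  simpa using h

lemma integral_sq_mul_le_of_le_divergence {F : Fin 3 → EuclideanSpace ℝ (Fin 3) → ℝ}
    {V : EuclideanSpace ℝ (Fin 3) → ℝ} {S : Set (EuclideanSpace ℝ (Fin 3))} {k K : ℝ}
    (hk : 0 < k) (hK : 0 ≤ K) (hS : MeasurableSet S) (hF : ∀ i, ContDiff ℝ 1 (F i))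
    (hFS : ∀ i, ∀ x ∉ S, F i x = 0) (hV : Continuous V)
    (hFk : ∀ x, ∑ i, F i x ^ 2 ≤ k * ∑ i, fderiv ℝ (F i) x (EuclideanSpace.single i 1))
    (hVK : ∀ x, V x ≤ K * ∑ i, fderiv ℝ (F i) x (EuclideanSpace.single i 1))
    {u : EuclideanSpace ℝ (Fin 3) → ℝ} (hu : ContDiff ℝ 1 u) (hc : HasCompactSupport u) :
    ∫ x, u x ^ 2 * V x ≤ K * (4 * k) * ∫ x in S, ‖fderiv ℝ u x‖ ^ 2 := by
  have hG : ∀ i, ContDiff ℝ 1 (fun x => u x ^ 2 * F i x) := fun i => (hu.pow 2).mul (hF i)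
  have hu2 : HasCompactSupport (fun x => u x ^ 2) := by
    simp only [sq]
    exact hc.mul_left (f := u)
  have hGc : ∀ i, HasCompactSupport (fun x => u x ^ 2 * F i x) := fun i => hu2.mul_right
  have hGi : ∀ i, Integrable
      (fun x => fderiv ℝ (fun x => u x ^ 2 * F i x) x (EuclideanSpace.single i 1)) := fun i =>
    (((hG i).continuous_fderiv one_ne_zero).clm_apply
      continuous_const).integrable_of_hasCompactSupport ((hGc i).fderiv_apply ℝ _)
  have hGf : ∀ i x, fderiv ℝ (fun x => u x ^ 2 * F i x) x (EuclideanSpace.single i 1) =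
      u x ^ 2 * fderiv ℝ (F i) x (EuclideanSpace.single i 1) +
        2 * u x * (F i x * fderiv ℝ u x (EuclideanSpace.single i 1)) := by
    intro i x
    have h1 := (hu.differentiable one_ne_zero x).hasFDerivAt
    have h2 := ((hF i).differentiable one_ne_zero x).hasFDerivAt
    have h3 : HasFDerivAt (fun x => u x ^ 2 * F i x) _ x := (h1.pow 2).mul h2
    rw [h3.fderiv]
    simp
    ring
  have hdu : Integrable (fun x => ‖fderiv ℝ u x‖ ^ 2) := by
    refine Continuous.integrable_of_hasCompactSupport
      ((hu.continuous_fderiv one_ne_zero).norm.pow 2) ?_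
    exact (hc.fderiv ℝ).comp_left (g := fun L => ‖L‖ ^ 2) (by simp)
  have hpt : ∀ x, u x ^ 2 * V x ≤
      K * (2 * ∑ i, fderiv ℝ (fun x => u x ^ 2 * F i x) x (EuclideanSpace.single i 1) +
        4 * k * S.indicator (fun x => ‖fderiv ℝ u x‖ ^ 2) x) := by
    intro x
    have h1 : u x ^ 2 * V x ≤
        u x ^ 2 * (K * ∑ i, fderiv ℝ (F i) x (EuclideanSpace.single i 1)) :=
      mul_le_mul_of_nonneg_left (hVK x) (sq_nonneg _)
    refine h1.trans ?_
    rw [mul_left_comm]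
    refine mul_le_mul_of_nonneg_left ?_ hK
    simp only [hGf]
    have hFx := hFk x
    by_cases hx : x ∈ S
    · rw [Set.indicator_of_mem hx, sum_sq_single_eq_norm_sq]
      simp only [Fin.sum_univ_three] at hFx ⊢
      have key : ∀ f g : ℝ, 0 ≤ u x ^ 2 * f ^ 2 + 4 * k * (u x * (f * g)) + 4 * k ^ 2 * g ^ 2 := by
        intro f g
        nlinarith [sq_nonneg (u x * f + 2 * k * g)]
      have k0 := key (F 0 x) (fderiv ℝ u x (EuclideanSpace.single 0 1))
      have k1 := key (F 1 x) (fderiv ℝ u x (EuclideanSpace.single 1 1))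
      have k2 := key (F 2 x) (fderiv ℝ u x (EuclideanSpace.single 2 1))
      have h3 := mul_le_mul_of_nonneg_left hFx (sq_nonneg (u x))
      rw [← sub_nonneg]
      refine nonneg_of_mul_nonneg_right (a := k) ?_ hk
      nlinarith
    · rw [Set.indicator_of_notMem hx]
      have h0 : ∀ i, F i x = 0 := fun i => hFS i x hx
      simp only [h0, zero_pow two_ne_zero, Finset.sum_const_zero, Fin.sum_univ_three] at hFx ⊢
      have := mul_nonneg (sq_nonneg (u x)) (nonneg_of_mul_nonneg_right hFx hk)
      linarith
  have hI : Integrable (fun x => u x ^ 2 * V x) :=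
    ((hu.continuous.pow 2).mul hV).integrable_of_hasCompactSupport hu2.mul_right
  have hdS : Integrable (S.indicator (fun x => ‖fderiv ℝ u x‖ ^ 2)) := hdu.indicator hS
  have hsum : Integrable (fun x =>
      ∑ i, fderiv ℝ (fun x => u x ^ 2 * F i x) x (EuclideanSpace.single i 1)) :=
    integrable_finsetSum _ fun i _ => hGi i
  refine (integral_mono hI (((hsum.const_mul 2).add (hdS.const_mul (4 * k))).const_mul K)
    hpt).trans_eq ?_
  simp only [Pi.add_apply]
  rw [integral_const_mul, integral_add (hsum.const_mul 2) (hdS.const_mul (4 * k)),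
    integral_const_mul, integral_const_mul, integral_finsetSum _ fun i _ => hGi i,
    integral_indicator hS]
  simp only [integral_fderiv_apply_eq_zero (hG _) (hGc _)]
  simp
  ring

lemma deriv_smoothTransition_eq_zero {x : ℝ} (h : x ≤ 0 ∨ 1 ≤ x) :
    deriv Real.smoothTransition x = 0 := by
  rcases h with h | h
  · refine IsLocalMin.deriv_eq_zero (Eventually.of_forall fun y => ?_)
    rw [Real.smoothTransition.zero_of_nonpos h]
    exact Real.smoothTransition.nonneg y
  · refine IsLocalMax.deriv_eq_zero (Eventually.of_forall fun y => ?_)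
    rw [Real.smoothTransition.one_of_one_le h]
    exact Real.smoothTransition.le_one y

lemma exists_abs_deriv_smoothTransition_le :
    ∃ C : ℝ, 0 < C ∧ ∀ x, |deriv Real.smoothTransition x| ≤ C := by
  have hcont : Continuous (deriv Real.smoothTransition) :=
    (Real.smoothTransition.contDiff (n := 1)).continuous_deriv le_rfl
  obtain ⟨C, hC⟩ := (isCompact_Icc (a := (0 : ℝ)) (b := 1)).exists_bound_of_continuousOn
    hcont.continuousOn
  refine ⟨max C 1, by positivity, fun x => ?_⟩
  by_cases hx : x ∈ Set.Icc (0 : ℝ) 1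
  · exact (hC x hx).trans (le_max_left _ _)
  · rw [deriv_smoothTransition_eq_zero]
    · simp
    · rw [Set.mem_Icc, not_and_or, not_le, not_le] at hx
      exact hx.imp le_of_lt le_of_lt

lemma hasDerivAt_smoothTransition (x : ℝ) :
    HasDerivAt Real.smoothTransition (deriv Real.smoothTransition x) x :=
  ((Real.smoothTransition.contDiff (n := 1)).differentiable one_ne_zero x).hasDerivAt

lemma fderiv_apply_single_eq {f : EuclideanSpace ℝ (Fin 3) → ℝ} {x : EuclideanSpace ℝ (Fin 3)}
    (hf : DifferentiableAt ℝ f x) {i : Fin 3} {g : ℝ → ℝ} {g' : ℝ}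
    (hg : ∀ t : ℝ, f (x + t • EuclideanSpace.single i (1 : ℝ)) = g (x i + t))
    (h : HasDerivAt g g' (x i)) :
    fderiv ℝ f x (EuclideanSpace.single i 1) = g' := by
  rw [← hf.lineDeriv_eq_fderiv]
  refine HasLineDerivAt.lineDeriv ?_
  unfold HasLineDerivAt
  simp only [hg]
  refine HasDerivAt.comp_const_add (x i) 0 ?_
  simpa using h

lemma hasDerivAt_axial_component (R b c a : ℝ) :
    HasDerivAt (fun t => Real.smoothTransition (2 * (t ^ 2 + b ^ 2 + c ^ 2) / R ^ 2 - 1) *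
        (2 / (2 + t ^ 2 + b ^ 2 + c ^ 2)) * t)
      (deriv Real.smoothTransition (2 * (a ^ 2 + b ^ 2 + c ^ 2) / R ^ 2 - 1) * (4 * a / R ^ 2) *
          (2 / (2 + a ^ 2 + b ^ 2 + c ^ 2)) * a +
        Real.smoothTransition (2 * (a ^ 2 + b ^ 2 + c ^ 2) / R ^ 2 - 1) *
          (2 / (2 + a ^ 2 + b ^ 2 + c ^ 2) - 4 * a ^ 2 / (2 + a ^ 2 + b ^ 2 + c ^ 2) ^ 2)) a := by
  have hD : 2 + a ^ 2 + b ^ 2 + c ^ 2 ≠ 0 := by positivity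
  have h1 : HasDerivAt (fun t : ℝ => t ^ 2) (2 * a) a := by simpa using hasDerivAt_pow 2 a
  have h2 : HasDerivAt (fun t : ℝ => 2 * (t ^ 2 + b ^ 2 + c ^ 2) / R ^ 2 - 1) (4 * a / R ^ 2) a := by
    exact (((((h1.add_const (b ^ 2)).add_const (c ^ 2)).const_mul 2).div_const (R ^ 2)).sub_const
      1).congr_deriv (by ring)
  have h3 : HasDerivAt (fun t : ℝ => 2 / (2 + t ^ 2 + b ^ 2 + c ^ 2))
      (-(4 * a) / (2 + a ^ 2 + b ^ 2 + c ^ 2) ^ 2) a := by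
    exact ((hasDerivAt_const a (2 : ℝ)).fun_div
      (((h1.const_add 2).add_const (b ^ 2)).add_const (c ^ 2)) hD).congr_deriv (by ring)
  refine ((((hasDerivAt_smoothTransition _).comp a h2).fun_mul h3).fun_mul
    (hasDerivAt_id' a)).congr_deriv ?_
  simp only [Function.comp_apply]
  ring

lemma hasDerivAt_transverse_component (R a c b : ℝ)
    (hl : 1 + (Real.log (2 + a ^ 2 + b ^ 2 + c ^ 2) - Real.log (2 + b ^ 2 + c ^ 2)) / 2 ≠ 0) :
    HasDerivAt (fun t => Real.smoothTransition (2 * (a ^ 2 + t ^ 2 + c ^ 2) / R ^ 2 - 1) *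
        (2 / (2 + a ^ 2 + t ^ 2 + c ^ 2) + 1 / ((2 + t ^ 2 + c ^ 2) *
          (1 + (Real.log (2 + a ^ 2 + t ^ 2 + c ^ 2) - Real.log (2 + t ^ 2 + c ^ 2)) / 2))) * t)
      (deriv Real.smoothTransition (2 * (a ^ 2 + b ^ 2 + c ^ 2) / R ^ 2 - 1) * (4 * b / R ^ 2) *
          (2 / (2 + a ^ 2 + b ^ 2 + c ^ 2) + 1 / ((2 + b ^ 2 + c ^ 2) *
          (1 + (Real.log (2 + a ^ 2 + b ^ 2 + c ^ 2) - Real.log (2 + b ^ 2 + c ^ 2)) / 2))) * b +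
        Real.smoothTransition (2 * (a ^ 2 + b ^ 2 + c ^ 2) / R ^ 2 - 1) *
          (2 / (2 + a ^ 2 + b ^ 2 + c ^ 2) - 4 * b ^ 2 / (2 + a ^ 2 + b ^ 2 + c ^ 2) ^ 2 +
          1 / ((2 + b ^ 2 + c ^ 2) *
            (1 + (Real.log (2 + a ^ 2 + b ^ 2 + c ^ 2) - Real.log (2 + b ^ 2 + c ^ 2)) / 2)) -
          2 * b ^ 2 / ((2 + b ^ 2 + c ^ 2) ^ 2 *
            (1 + (Real.log (2 + a ^ 2 + b ^ 2 + c ^ 2) - Real.log (2 + b ^ 2 + c ^ 2)) / 2)) -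
          b ^ 2 / ((2 + b ^ 2 + c ^ 2) *
            (1 + (Real.log (2 + a ^ 2 + b ^ 2 + c ^ 2) - Real.log (2 + b ^ 2 + c ^ 2)) / 2) ^ 2) *
            (1 / (2 + a ^ 2 + b ^ 2 + c ^ 2) - 1 / (2 + b ^ 2 + c ^ 2)))) b := by
  have hD : 2 + a ^ 2 + b ^ 2 + c ^ 2 ≠ 0 := by positivity
  have hE : 2 + b ^ 2 + c ^ 2 ≠ 0 := by positivity
  have h1 : HasDerivAt (fun t : ℝ => t ^ 2) (2 * b) b := by simpa using hasDerivAt_pow 2 b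
  have h2 : HasDerivAt (fun t : ℝ => 2 * (a ^ 2 + t ^ 2 + c ^ 2) / R ^ 2 - 1) (4 * b / R ^ 2) b := by
    exact (((((h1.const_add (a ^ 2)).add_const (c ^ 2)).const_mul 2).div_const (R ^ 2)).sub_const
      1).congr_deriv (by ring)
  have hd := (h1.const_add (2 + a ^ 2)).add_const (c ^ 2)
  have he := (h1.const_add 2).add_const (c ^ 2)
  have hlam := (((hd.log hD).fun_sub (he.log hE)).div_const 2).const_add 1
  have h3 := ((hasDerivAt_const b (2 : ℝ)).fun_div hd hD).fun_add
    ((hasDerivAt_const b (1 : ℝ)).fun_div (he.fun_mul hlam) (mul_ne_zero hE hl))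
  refine ((((hasDerivAt_smoothTransition _).comp b h2).fun_mul h3).fun_mul
    (hasDerivAt_id' b)).congr_deriv ?_
  simp only [Function.comp_apply]
  generalize 1 + (Real.log (2 + a ^ 2 + b ^ 2 + c ^ 2) - Real.log (2 + b ^ 2 + c ^ 2)) / 2 = l at *
  generalize 2 + a ^ 2 + b ^ 2 + c ^ 2 = D at *
  generalize 2 + b ^ 2 + c ^ 2 = E at *
  generalize deriv Real.smoothTransition (2 * (a ^ 2 + b ^ 2 + c ^ 2) / R ^ 2 - 1) = s
  generalize Real.smoothTransition (2 * (a ^ 2 + b ^ 2 + c ^ 2) / R ^ 2 - 1) = θ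
  generalize 4 * b / R ^ 2 = w
  field_simp
  ring

lemma divergence_bounds {θ s p b c D E l : ℝ} (hθ : 0 ≤ θ) (hθ1 : θ ≤ 1) (hs : 0 ≤ s)
    (hp : 0 ≤ p) (hl : 1 ≤ l) (hE : E = 2 + b ^ 2 + c ^ 2) (hD : D = 2 + p + b ^ 2 + c ^ 2) :
    θ * (1 / D + (b ^ 2 + c ^ 2) / (E ^ 2 * l ^ 2)) ≤
      (s * p * (2 / D) + θ * (2 / D - 4 * p / D ^ 2)) +
      (s * b ^ 2 * (2 / D + 1 / (E * l)) + θ * (2 / D - 4 * b ^ 2 / D ^ 2 + 1 / (E * l) -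
        2 * b ^ 2 / (E ^ 2 * l) - b ^ 2 / (E * l ^ 2) * (1 / D - 1 / E))) +
      (s * c ^ 2 * (2 / D + 1 / (E * l)) + θ * (2 / D - 4 * c ^ 2 / D ^ 2 + 1 / (E * l) -
        2 * c ^ 2 / (E ^ 2 * l) - c ^ 2 / (E * l ^ 2) * (1 / D - 1 / E))) ∧
    θ ^ 2 * (4 * p / D ^ 2 + (b ^ 2 + c ^ 2) * (2 / D + 1 / (E * l)) ^ 2) ≤
      8 * (θ * (1 / D + (b ^ 2 + c ^ 2) / (E ^ 2 * l ^ 2))) := by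
  have hE0 : 0 < E := by rw [hE]; positivity
  have hD0 : 0 < D := by rw [hD]; positivity
  have hl0 : 0 < l := by linarith
  set q := b ^ 2 + c ^ 2 with hq
  have hq0 : 0 ≤ q := by positivity
  have hE' : E = 2 + q := by rw [hE, hq]; ring
  have hD' : D = 2 + p + q := by rw [hD, hq]; ring
  have e1 : (p + q) / D ^ 2 ≤ 1 / D := by
    rw [div_le_div_iff₀ (by positivity) hD0]
    nlinarith
  have e2 : q / (E * l ^ 2) * (1 / D) ≤ 1 / D := by
    refine mul_le_of_le_one_left (by positivity) ?_
    rw [div_le_one (by positivity)]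
    nlinarith [one_le_pow₀ hl (n := 2)]
  have e3 : 2 * q / (E ^ 2 * l) ≤ 2 / (E * l) := by
    rw [div_le_div_iff₀ (by positivity) (by positivity)]
    have : 0 ≤ E * l * (E - q) := mul_nonneg (by positivity) (by linarith)
    nlinarith
  constructor
  · have h1 : 0 ≤ s * p * (2 / D) + s * q * (2 / D + 1 / (E * l)) := by positivity
    have h2 : 1 / D + q / (E ^ 2 * l ^ 2) ≤ 6 / D - 4 * ((p + q) / D ^ 2) + 2 / (E * l) -
        2 * q / (E ^ 2 * l) - q / (E * l ^ 2) * (1 / D - 1 / E) := by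
      have h3 : q / (E * l ^ 2) * (1 / D - 1 / E) =
          q / (E * l ^ 2) * (1 / D) - q / (E ^ 2 * l ^ 2) := by field_simp
      have h4 : 6 / D = 6 * (1 / D) := by ring
      rw [h3, h4]
      linarith
    have h5 := mul_le_mul_of_nonneg_left h2 hθ
    refine (h5.trans (le_add_of_nonneg_left h1)).trans_eq ?_
    rw [hq]
    ring
  · have h1 : θ ^ 2 ≤ θ := by nlinarith
    have h2 : 4 * p / D ^ 2 + q * (2 / D + 1 / (E * l)) ^ 2 ≤
        8 * (1 / D + q / (E ^ 2 * l ^ 2)) := by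
      have h3 : (2 / D + 1 / (E * l)) ^ 2 ≤ 8 / D ^ 2 + 2 / (E ^ 2 * l ^ 2) := by
        have : 8 / D ^ 2 + 2 / (E ^ 2 * l ^ 2) - (2 / D + 1 / (E * l)) ^ 2 =
          (2 / D - 1 / (E * l)) ^ 2 := by field_simp; ring
        nlinarith [sq_nonneg (2 / D - 1 / (E * l))]
      have h4 := mul_le_mul_of_nonneg_left h3 hq0
      have h5 : q * (8 / D ^ 2 + 2 / (E ^ 2 * l ^ 2)) =
        8 * ((p + q) / D ^ 2) - 8 * (p / D ^ 2) + 2 * (q / (E ^ 2 * l ^ 2)) := by ring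
      have h6 : 4 * p / D ^ 2 = 4 * (p / D ^ 2) := by ring
      have h7 : 0 ≤ p / D ^ 2 := by positivity
      have h8 : 0 ≤ q / (E ^ 2 * l ^ 2) := by positivity
      linarith
    calc _ ≤ θ * (4 * p / D ^ 2 + q * (2 / D + 1 / (E * l)) ^ 2) :=
          mul_le_mul_of_nonneg_right h1 (by positivity)
      _ ≤ θ * (8 * (1 / D + q / (E ^ 2 * l ^ 2))) := mul_le_mul_of_nonneg_left h2 hθ
      _ = _ := by ring

/-- A vector field vanishing on `‖x‖ < R / √2`, whose divergence controls its squared length, the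
Hardy weight and a logarithmically corrected transverse Hardy weight. -/
noncomputable def hardyField (R : ℝ) (i : Fin 3) (x : EuclideanSpace ℝ (Fin 3)) : ℝ :=
  Real.smoothTransition (2 * (x 0 ^ 2 + x 1 ^ 2 + x 2 ^ 2) / R ^ 2 - 1) *
    (2 / (2 + x 0 ^ 2 + x 1 ^ 2 + x 2 ^ 2) + (if i = 0 then 0 else 1) / ((2 + x 1 ^ 2 + x 2 ^ 2) *
      (1 + (Real.log (2 + x 0 ^ 2 + x 1 ^ 2 + x 2 ^ 2) - Real.log (2 + x 1 ^ 2 + x 2 ^ 2)) / 2))) *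
    x i

/-- The weight controlled by the divergence of `hardyField R`. -/
noncomputable def hardyWeight (R : ℝ) (x : EuclideanSpace ℝ (Fin 3)) : ℝ :=
  Real.smoothTransition (2 * (x 0 ^ 2 + x 1 ^ 2 + x 2 ^ 2) / R ^ 2 - 1) *
    (1 / (2 + x 0 ^ 2 + x 1 ^ 2 + x 2 ^ 2) +
      (x 1 ^ 2 + x 2 ^ 2) / ((2 + x 1 ^ 2 + x 2 ^ 2) ^ 2 *
        (1 + (Real.log (2 + x 0 ^ 2 + x 1 ^ 2 + x 2 ^ 2) -
          Real.log (2 + x 1 ^ 2 + x 2 ^ 2)) / 2) ^ 2))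

lemma one_le_one_add_log_sub_log (a b c : ℝ) :
    1 ≤ 1 + (Real.log (2 + a ^ 2 + b ^ 2 + c ^ 2) - Real.log (2 + b ^ 2 + c ^ 2)) / 2 := by
  have := Real.log_le_log (x := 2 + b ^ 2 + c ^ 2) (y := 2 + a ^ 2 + b ^ 2 + c ^ 2) (by positivity)
    (by nlinarith [sq_nonneg a])
  linarith

lemma contDiff_hardyField (R : ℝ) (i : Fin 3) : ContDiff ℝ 1 (hardyField R i) := by
  unfold hardyField
  have hD : ∀ x : EuclideanSpace ℝ (Fin 3), 2 + x 0 ^ 2 + x 1 ^ 2 + x 2 ^ 2 ≠ 0 :=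
    fun x => by positivity
  have hE : ∀ x : EuclideanSpace ℝ (Fin 3), 2 + x 1 ^ 2 + x 2 ^ 2 ≠ 0 := fun x => by positivity
  have hx : ∀ j : Fin 3, ContDiff ℝ 1 (fun x : EuclideanSpace ℝ (Fin 3) => x j) :=
    fun j => contDiff_piLp_apply (p := 2)
  have hN := (((hx 0).pow 2).add ((hx 1).pow 2)).add ((hx 2).pow 2)
  have hDc := ((contDiff_const (c := (2 : ℝ)).add ((hx 0).pow 2)).add ((hx 1).pow 2)).add
    ((hx 2).pow 2)
  have hEc := (contDiff_const (c := (2 : ℝ)).add ((hx 1).pow 2)).add ((hx 2).pow 2)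
  have hl := contDiff_const (c := (1 : ℝ)).add (((hDc.log hD).sub (hEc.log hE)).div_const 2)
  refine ContDiff.mul (ContDiff.mul ?_ ?_) (hx i)
  · exact (Real.smoothTransition.contDiff (n := 1)).comp
      (((contDiff_const.mul hN).div_const _).sub contDiff_const)
  · exact (contDiff_const.div hDc hD).add (contDiff_const.div (hEc.mul hl) fun x =>
      mul_ne_zero (hE x) (one_pos.trans_le (one_le_one_add_log_sub_log _ _ _)).ne')

lemma norm_sq_eq_three (x : EuclideanSpace ℝ (Fin 3)) :
    ‖x‖ ^ 2 = x 0 ^ 2 + x 1 ^ 2 + x 2 ^ 2 := by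
  simp [EuclideanSpace.norm_sq_eq, Fin.sum_univ_three]

lemma le_norm_of_sq_le {R : ℝ} {x : EuclideanSpace ℝ (Fin 3)}
    (h : R ^ 2 ≤ 2 * (x 0 ^ 2 + x 1 ^ 2 + x 2 ^ 2)) : R / √2 ≤ ‖x‖ := by
  refine le_of_sq_le_sq ?_ (norm_nonneg x)
  rw [div_pow, Real.sq_sqrt zero_le_two, norm_sq_eq_three]
  linarith

lemma hardyField_eq_zero {R : ℝ} (hR : 0 < R) (i : Fin 3) {x : EuclideanSpace ℝ (Fin 3)}
    (hx : x ∉ {x : EuclideanSpace ℝ (Fin 3) | R / √2 ≤ ‖x‖}) : hardyField R i x = 0 := by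
  unfold hardyField
  rw [Real.smoothTransition.zero_of_nonpos]
  · simp
  · by_contra! h
    refine hx (le_norm_of_sq_le ?_)
    rw [sub_pos, one_lt_div (by positivity)] at h
    exact h.le

lemma hardyField_divergence_bounds (R : ℝ) (x : EuclideanSpace ℝ (Fin 3)) :
    hardyWeight R x ≤ ∑ i, fderiv ℝ (hardyField R i) x (EuclideanSpace.single i 1) ∧
      ∑ i, hardyField R i x ^ 2 ≤ 8 * hardyWeight R x := by
  have hl := one_le_one_add_log_sub_log (x 0) (x 1) (x 2)
  have hl' := one_le_one_add_log_sub_log (x 0) (x 2) (x 1)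
  have d := fun i => (contDiff_hardyField R i).differentiable one_ne_zero x
  have d0 := fderiv_apply_single_eq (d 0) (fun t => by simp [hardyField])
    (hasDerivAt_axial_component R (x 1) (x 2) (x 0))
  have d1 := fderiv_apply_single_eq (d 1) (fun t => by simp [hardyField])
    (hasDerivAt_transverse_component R (x 0) (x 2) (x 1) (by linarith))
  have d2 := fderiv_apply_single_eq (d 2) (fun t => by simp [hardyField, add_right_comm])
    (hasDerivAt_transverse_component R (x 0) (x 1) (x 2) (by linarith))
  have hN : x 0 ^ 2 + x 2 ^ 2 + x 1 ^ 2 = x 0 ^ 2 + x 1 ^ 2 + x 2 ^ 2 := by ring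
  have hD : 2 + x 0 ^ 2 + x 2 ^ 2 + x 1 ^ 2 = 2 + x 0 ^ 2 + x 1 ^ 2 + x 2 ^ 2 := by ring
  have hE : 2 + x 2 ^ 2 + x 1 ^ 2 = 2 + x 1 ^ 2 + x 2 ^ 2 := by ring
  rw [hN, hD, hE] at d2
  have hs : 0 ≤ deriv Real.smoothTransition (2 * (x 0 ^ 2 + x 1 ^ 2 + x 2 ^ 2) / R ^ 2 - 1) *
      (4 / R ^ 2) := mul_nonneg Real.smoothTransition.monotone.deriv_nonneg (by positivity)
  obtain ⟨h1, h2⟩ := divergence_bounds (Real.smoothTransition.nonneg _)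
    (Real.smoothTransition.le_one _) hs (sq_nonneg (x 0)) hl rfl rfl
  simp only [Fin.sum_univ_three]
  constructor
  · rw [d0, d1, d2]
    unfold hardyWeight
    refine h1.trans_eq ?_
    ring
  · unfold hardyWeight
    refine le_trans (le_of_eq ?_) h2
    simp only [hardyField, if_true, if_neg (show (1 : Fin 3) ≠ 0 by decide),
      if_neg (show (2 : Fin 3) ≠ 0 by decide)]
    generalize 1 + (Real.log (2 + x 0 ^ 2 + x 1 ^ 2 + x 2 ^ 2) -
      Real.log (2 + x 1 ^ 2 + x 2 ^ 2)) / 2 = l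
    generalize 2 + x 0 ^ 2 + x 1 ^ 2 + x 2 ^ 2 = D
    generalize 2 + x 1 ^ 2 + x 2 ^ 2 = E
    generalize Real.smoothTransition (2 * (x 0 ^ 2 + x 1 ^ 2 + x 2 ^ 2) / R ^ 2 - 1) = θ
    ring

/-- An anisotropic cut-off function: with `P = 2 + R ^ 2`, it varies over `P ^ 4 ≤ |x₁| ≤ √2 P ^ 4`
axially and logarithmically over `P ≤ 2 + x₂² + x₃² ≤ P ^ 2` transversally. -/
noncomputable def cutoff (R : ℝ) (x : EuclideanSpace ℝ (Fin 3)) : ℝ :=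
  Real.smoothTransition (2 - x 0 ^ 2 / (2 + R ^ 2) ^ 8) *
    Real.smoothTransition (2 - Real.log (2 + x 1 ^ 2 + x 2 ^ 2) / Real.log (2 + R ^ 2))

lemma log_two_add_sq_pos (R : ℝ) : 0 < Real.log (2 + R ^ 2) :=
  Real.log_pos (by nlinarith [sq_nonneg R])

lemma contDiff_cutoff (R : ℝ) {n : ℕ∞} : ContDiff ℝ n (cutoff R) := by
  unfold cutoff
  have hE : ∀ x : EuclideanSpace ℝ (Fin 3), 2 + x 1 ^ 2 + x 2 ^ 2 ≠ 0 := fun x => by positivity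
  have hx : ∀ j : Fin 3, ContDiff ℝ n (fun x : EuclideanSpace ℝ (Fin 3) => x j) :=
    fun j => contDiff_piLp_apply (p := 2)
  have hEc := (contDiff_const (c := (2 : ℝ)).add ((hx 1).pow 2)).add ((hx 2).pow 2)
  exact (Real.smoothTransition.contDiff.comp (contDiff_const.sub (((hx 0).pow 2).div_const _))).mul
    (Real.smoothTransition.contDiff.comp (contDiff_const.sub ((hEc.log hE).div_const _)))

lemma fderiv_cutoff_apply_axial (R : ℝ) (x : EuclideanSpace ℝ (Fin 3)) :
    fderiv ℝ (cutoff R) x (EuclideanSpace.single 0 1) =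
      deriv Real.smoothTransition (2 - x 0 ^ 2 / (2 + R ^ 2) ^ 8) *
        (-(2 * x 0) / (2 + R ^ 2) ^ 8) *
        Real.smoothTransition (2 - Real.log (2 + x 1 ^ 2 + x 2 ^ 2) / Real.log (2 + R ^ 2)) := by
  have h1 : HasDerivAt (fun t : ℝ => t ^ 2) (2 * x 0) (x 0) := by simpa using hasDerivAt_pow 2 (x 0)
  have h2 := (h1.div_const ((2 + R ^ 2) ^ 8)).const_sub 2
  have h3 := ((hasDerivAt_smoothTransition _).comp (x 0) h2).mul_const (Real.smoothTransition
    (2 - Real.log (2 + x 1 ^ 2 + x 2 ^ 2) / Real.log (2 + R ^ 2)))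
  rw [fderiv_apply_single_eq ((contDiff_cutoff R (n := 1)).differentiable one_ne_zero x)
    (fun t => by simp [cutoff]) h3]
  ring

lemma hasDerivAt_transverse_profile (b c T : ℝ) :
    HasDerivAt (fun t => Real.smoothTransition (2 - Real.log (2 + t ^ 2 + c ^ 2) / T))
      (deriv Real.smoothTransition (2 - Real.log (2 + b ^ 2 + c ^ 2) / T) *
        (-(2 * b / (2 + b ^ 2 + c ^ 2) / T))) b := by
  have h1 : HasDerivAt (fun t : ℝ => t ^ 2) (2 * b) b := by simpa using hasDerivAt_pow 2 b
  exact (hasDerivAt_smoothTransition _).comp b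
    (((((h1.const_add 2).add_const (c ^ 2)).log (by positivity)).div_const T).const_sub 2)

lemma fderiv_cutoff_apply_transverse (R : ℝ) (x : EuclideanSpace ℝ (Fin 3)) {i : Fin 3}
    (hi : i ≠ 0) :
    fderiv ℝ (cutoff R) x (EuclideanSpace.single i 1) =
      Real.smoothTransition (2 - x 0 ^ 2 / (2 + R ^ 2) ^ 8) *
        (deriv Real.smoothTransition
          (2 - Real.log (2 + x 1 ^ 2 + x 2 ^ 2) / Real.log (2 + R ^ 2)) *
        (-(2 * x i / (2 + x 1 ^ 2 + x 2 ^ 2) / Real.log (2 + R ^ 2)))) := by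
  have hd := (contDiff_cutoff R (n := 1)).differentiable one_ne_zero x
  fin_cases i
  · exact absurd rfl hi
  · exact fderiv_apply_single_eq (i := 1) hd (fun t => by simp [cutoff])
      ((hasDerivAt_transverse_profile (x 1) (x 2) (Real.log (2 + R ^ 2))).const_mul _)
  · have h := (hasDerivAt_transverse_profile (x 2) (x 1) (Real.log (2 + R ^ 2))).const_mul
      (Real.smoothTransition (2 - x 0 ^ 2 / (2 + R ^ 2) ^ 8))
    have hE : 2 + x 2 ^ 2 + x 1 ^ 2 = 2 + x 1 ^ 2 + x 2 ^ 2 := by ring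
    rw [hE] at h
    exact fderiv_apply_single_eq (i := 2) hd (fun t => by simp [cutoff, add_right_comm]) h

lemma lt_sq_of_transverse_ne_zero {R E : ℝ} (hE : 0 < E)
    (h : Real.smoothTransition (2 - Real.log E / Real.log (2 + R ^ 2)) ≠ 0) :
    E < (2 + R ^ 2) ^ 2 := by
  rw [Ne, Real.smoothTransition.zero_iff_nonpos, not_le, sub_pos,
    div_lt_iff₀ (log_two_add_sq_pos R)] at h
  rw [← Real.log_lt_log_iff hE (by positivity), Real.log_pow]
  exact_mod_cast h

lemma lt_of_axial_ne_zero {R a : ℝ}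
    (h : Real.smoothTransition (2 - a ^ 2 / (2 + R ^ 2) ^ 8) ≠ 0) :
    a ^ 2 < 2 * (2 + R ^ 2) ^ 8 := by
  rwa [Ne, Real.smoothTransition.zero_iff_nonpos, not_le, sub_pos,
    div_lt_iff₀ (by positivity)] at h

lemma mem_Ioo_of_deriv_smoothTransition_ne_zero {x : ℝ}
    (h : deriv Real.smoothTransition x ≠ 0) : 0 < x ∧ x < 1 := by
  constructor <;> by_contra! hx
  · exact h (deriv_smoothTransition_eq_zero (.inl hx))
  · exact h (deriv_smoothTransition_eq_zero (.inr hx))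

lemma lt_of_axial_deriv_ne_zero {R a : ℝ}
    (h : deriv Real.smoothTransition (2 - a ^ 2 / (2 + R ^ 2) ^ 8) ≠ 0) :
    (2 + R ^ 2) ^ 8 < a ^ 2 ∧ a ^ 2 < 2 * (2 + R ^ 2) ^ 8 := by
  obtain ⟨h1, h2⟩ := mem_Ioo_of_deriv_smoothTransition_ne_zero h
  have h3 : 1 < a ^ 2 / (2 + R ^ 2) ^ 8 := by linarith
  have h4 : a ^ 2 / (2 + R ^ 2) ^ 8 < 2 := by linarith
  rw [lt_div_iff₀ (by positivity)] at h3
  rw [div_lt_iff₀ (by positivity)] at h4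
  exact ⟨by linarith, h4⟩

lemma sq_le_of_fderiv_cutoff_axial_ne_zero {R : ℝ} {x : EuclideanSpace ℝ (Fin 3)}
    (h : fderiv ℝ (cutoff R) x (EuclideanSpace.single 0 1) ≠ 0) :
    (2 + R ^ 2) ^ 8 < x 0 ^ 2 ∧ x 0 ^ 2 < 2 * (2 + R ^ 2) ^ 8 ∧
      2 + x 1 ^ 2 + x 2 ^ 2 < (2 + R ^ 2) ^ 2 := by
  rw [fderiv_cutoff_apply_axial] at h
  obtain ⟨h1, h2⟩ := lt_of_axial_deriv_ne_zero (left_ne_zero_of_mul (left_ne_zero_of_mul h))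
  exact ⟨h1, h2, lt_sq_of_transverse_ne_zero (by positivity) (right_ne_zero_of_mul h)⟩

lemma sq_le_of_fderiv_cutoff_transverse_ne_zero {R : ℝ} {x : EuclideanSpace ℝ (Fin 3)} {i : Fin 3}
    (hi : i ≠ 0) (h : fderiv ℝ (cutoff R) x (EuclideanSpace.single i 1) ≠ 0) :
    x 0 ^ 2 < 2 * (2 + R ^ 2) ^ 8 ∧ 2 + R ^ 2 < 2 + x 1 ^ 2 + x 2 ^ 2 ∧
      2 + x 1 ^ 2 + x 2 ^ 2 < (2 + R ^ 2) ^ 2 := by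
  rw [fderiv_cutoff_apply_transverse R x hi] at h
  obtain ⟨h1, h2⟩ := mem_Ioo_of_deriv_smoothTransition_ne_zero
    (left_ne_zero_of_mul (right_ne_zero_of_mul h))
  refine ⟨lt_of_axial_ne_zero (left_ne_zero_of_mul h), ?_, ?_⟩
  · rw [← Real.log_lt_log_iff (by positivity) (by positivity),
      ← one_lt_div (log_two_add_sq_pos R)]
    linarith
  · refine lt_sq_of_transverse_ne_zero (by positivity) ?_
    rw [Ne, Real.smoothTransition.zero_iff_nonpos, not_le]
    exact h1

lemma sq_le_pow_eight (R : ℝ) : R ^ 2 ≤ (2 + R ^ 2) ^ 8 := by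
  have h : 1 ≤ 2 + R ^ 2 := by nlinarith [sq_nonneg R]
  linarith [le_self_pow₀ h (n := 8) (by norm_num)]

lemma sq_le_of_fderiv_cutoff_ne_zero {R : ℝ} {x : EuclideanSpace ℝ (Fin 3)} {i : Fin 3}
    (h : fderiv ℝ (cutoff R) x (EuclideanSpace.single i 1) ≠ 0) :
    R ^ 2 ≤ x 0 ^ 2 + x 1 ^ 2 + x 2 ^ 2 := by
  by_cases hi : i = 0
  · subst hi
    have := (sq_le_of_fderiv_cutoff_axial_ne_zero h).1
    nlinarith [sq_le_pow_eight R, sq_nonneg (x 1), sq_nonneg (x 2)]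
  · have := (sq_le_of_fderiv_cutoff_transverse_ne_zero hi h).2.1
    nlinarith [sq_nonneg (x 0)]

lemma hardyWeight_nonneg (R : ℝ) (x : EuclideanSpace ℝ (Fin 3)) : 0 ≤ hardyWeight R x := by
  unfold hardyWeight
  exact mul_nonneg (Real.smoothTransition.nonneg _) (by positivity)

lemma hardyWeight_eq_of_sq_le {R : ℝ} (hR : 0 < R) {x : EuclideanSpace ℝ (Fin 3)}
    (h : R ^ 2 ≤ x 0 ^ 2 + x 1 ^ 2 + x 2 ^ 2) :
    hardyWeight R x = 1 / (2 + x 0 ^ 2 + x 1 ^ 2 + x 2 ^ 2) +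
      (x 1 ^ 2 + x 2 ^ 2) / ((2 + x 1 ^ 2 + x 2 ^ 2) ^ 2 *
        (1 + (Real.log (2 + x 0 ^ 2 + x 1 ^ 2 + x 2 ^ 2) -
          Real.log (2 + x 1 ^ 2 + x 2 ^ 2)) / 2) ^ 2) := by
  unfold hardyWeight
  rw [Real.smoothTransition.one_of_one_le, one_mul]
  have : 1 ≤ (x 0 ^ 2 + x 1 ^ 2 + x 2 ^ 2) / R ^ 2 := by
    rwa [one_le_div (by positivity)]
  rw [mul_div_assoc]
  linarith

lemma fderiv_cutoff_axial_sq_le {C R : ℝ} (hC : ∀ x, |deriv Real.smoothTransition x| ≤ C)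
    (x : EuclideanSpace ℝ (Fin 3)) :
    fderiv ℝ (cutoff R) x (EuclideanSpace.single 0 1) ^ 2 ≤ 8 * C ^ 2 / (2 + R ^ 2) ^ 8 := by
  by_cases h : fderiv ℝ (cutoff R) x (EuclideanSpace.single 0 1) = 0
  · rw [h, zero_pow two_ne_zero]
    positivity
  · have h1 := (sq_le_of_fderiv_cutoff_axial_ne_zero h).2.1
    have h2 : deriv Real.smoothTransition (2 - x 0 ^ 2 / (2 + R ^ 2) ^ 8) ^ 2 ≤ C ^ 2 :=
      sq_le_sq' (neg_le_of_abs_le (hC _)) (le_of_abs_le (hC _))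
    have h3 : Real.smoothTransition
        (2 - Real.log (2 + x 1 ^ 2 + x 2 ^ 2) / Real.log (2 + R ^ 2)) ^ 2 ≤ 1 :=
      pow_le_one₀ (Real.smoothTransition.nonneg _) (Real.smoothTransition.le_one _)
    have h4 : (-(2 * x 0) / (2 + R ^ 2) ^ 8) ^ 2 ≤ 8 / (2 + R ^ 2) ^ 8 := by
      rw [div_pow, div_le_div_iff₀ (by positivity) (by positivity)]
      have : 0 < (2 + R ^ 2) ^ 8 := by positivity
      nlinarith [mul_pos this this]
    rw [fderiv_cutoff_apply_axial, mul_pow, mul_pow]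
    calc _ ≤ C ^ 2 * (8 / (2 + R ^ 2) ^ 8) * 1 := by gcongr
      _ = _ := by ring

lemma norm_fderiv_cutoff_sq_le {C R : ℝ} (hR : 0 < R)
    (hC : ∀ x, |deriv Real.smoothTransition x| ≤ C) (x : EuclideanSpace ℝ (Fin 3)) :
    ‖fderiv ℝ (cutoff R) x‖ ^ 2 ≤ 196 * C ^ 2 * hardyWeight R x := by
  rw [sum_sq_single_eq_norm_sq]
  by_cases hall : ∀ i, fderiv ℝ (cutoff R) x (EuclideanSpace.single i 1) = 0
  · simp only [hall]
    have := hardyWeight_nonneg R x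
    simp
    positivity
  push Not at hall
  obtain ⟨j, hj⟩ := hall
  rw [hardyWeight_eq_of_sq_le hR (sq_le_of_fderiv_cutoff_ne_zero hj), Fin.sum_univ_three, add_assoc,
    mul_add]
  have hP : 2 ≤ 2 + R ^ 2 := by nlinarith [sq_nonneg R]
  have hP28 : 4 * (2 + R ^ 2) ^ 2 ≤ (2 + R ^ 2) ^ 8 := by
    have h1 : (2 : ℝ) ^ 6 ≤ (2 + R ^ 2) ^ 6 := pow_le_pow_left₀ (by norm_num) hP 6
    have h2 : 0 ≤ (2 + R ^ 2) ^ 2 := by positivity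
    have h3 : (2 + R ^ 2) ^ 8 = (2 + R ^ 2) ^ 6 * (2 + R ^ 2) ^ 2 := by ring
    nlinarith
  refine add_le_add ?_ ?_
  · by_cases h : fderiv ℝ (cutoff R) x (EuclideanSpace.single 0 1) = 0
    · rw [h, zero_pow two_ne_zero]
      positivity
    · obtain ⟨-, h1, h2⟩ := sq_le_of_fderiv_cutoff_axial_ne_zero h
      refine (fderiv_cutoff_axial_sq_le hC x).trans ?_
      rw [mul_one_div, div_le_div_iff₀ (by positivity) (by positivity)]
      nlinarith [sq_nonneg C]
  · by_cases h : fderiv ℝ (cutoff R) x (EuclideanSpace.single 1 1) = 0 ∧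
      fderiv ℝ (cutoff R) x (EuclideanSpace.single 2 1) = 0
    · rw [h.1, h.2]
      have : 0 ≤ 196 * C ^ 2 * ((x 1 ^ 2 + x 2 ^ 2) / ((2 + x 1 ^ 2 + x 2 ^ 2) ^ 2 *
        (1 + (Real.log (2 + x 0 ^ 2 + x 1 ^ 2 + x 2 ^ 2) -
          Real.log (2 + x 1 ^ 2 + x 2 ^ 2)) / 2) ^ 2)) := by positivity
      simpa using this
    · obtain ⟨h1, -, h2⟩ : x 0 ^ 2 < 2 * (2 + R ^ 2) ^ 8 ∧ 2 + R ^ 2 < 2 + x 1 ^ 2 + x 2 ^ 2 ∧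
          2 + x 1 ^ 2 + x 2 ^ 2 < (2 + R ^ 2) ^ 2 := by
        rw [not_and_or] at h
        rcases h with h | h
        · exact sq_le_of_fderiv_cutoff_transverse_ne_zero (by decide) h
        · exact sq_le_of_fderiv_cutoff_transverse_ne_zero (by decide) h
      have hT := log_two_add_sq_pos R
      have hT2 : 1 ≤ 2 * Real.log (2 + R ^ 2) := by
        have := Real.log_le_log two_pos hP
        linarith [Real.log_two_gt_d9]
      have hlogE : 0 ≤ Real.log (2 + x 1 ^ 2 + x 2 ^ 2) :=
        Real.log_nonneg (by nlinarith [sq_nonneg (x 1), sq_nonneg (x 2)])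
      have hlogD : Real.log (2 + x 0 ^ 2 + x 1 ^ 2 + x 2 ^ 2) ≤ 10 * Real.log (2 + R ^ 2) := by
        have h10 : (2 + R ^ 2) ^ 10 = (2 + R ^ 2) ^ 8 * (2 + R ^ 2) ^ 2 := by ring
        have : (10 : ℝ) * Real.log (2 + R ^ 2) = Real.log ((2 + R ^ 2) ^ 10) := by
          rw [Real.log_pow]; norm_num
        rw [this]
        refine Real.log_le_log (by positivity) ?_
        have h4 : (4 : ℝ) ≤ (2 + R ^ 2) ^ 2 := by nlinarith
        have h8 : 0 ≤ (2 + R ^ 2) ^ 8 := by positivity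
        nlinarith
      have hl := one_le_one_add_log_sub_log (x 0) (x 1) (x 2)
      have hlT : 1 + (Real.log (2 + x 0 ^ 2 + x 1 ^ 2 + x 2 ^ 2) -
          Real.log (2 + x 1 ^ 2 + x 2 ^ 2)) / 2 ≤ 7 * Real.log (2 + R ^ 2) := by linarith
      rw [fderiv_cutoff_apply_transverse R x (by decide),
        fderiv_cutoff_apply_transverse R x (by decide)]
      have h3 : deriv Real.smoothTransition
          (2 - Real.log (2 + x 1 ^ 2 + x 2 ^ 2) / Real.log (2 + R ^ 2)) ^ 2 ≤ C ^ 2 :=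
        sq_le_sq' (neg_le_of_abs_le (hC _)) (le_of_abs_le (hC _))
      have h4 : Real.smoothTransition (2 - x 0 ^ 2 / (2 + R ^ 2) ^ 8) ^ 2 ≤ 1 :=
        pow_le_one₀ (Real.smoothTransition.nonneg _) (Real.smoothTransition.le_one _)
      generalize Real.smoothTransition (2 - x 0 ^ 2 / (2 + R ^ 2) ^ 8) = θ at *
      generalize deriv Real.smoothTransition
          (2 - Real.log (2 + x 1 ^ 2 + x 2 ^ 2) / Real.log (2 + R ^ 2)) = s at *
      generalize 1 + (Real.log (2 + x 0 ^ 2 + x 1 ^ 2 + x 2 ^ 2) -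
          Real.log (2 + x 1 ^ 2 + x 2 ^ 2)) / 2 = l at *
      have hE : 0 < 2 + x 1 ^ 2 + x 2 ^ 2 := by positivity
      have hl0 : 0 < l := by linarith
      calc _ = θ ^ 2 * (s ^ 2 * (4 * (x 1 ^ 2 + x 2 ^ 2) /
              ((2 + x 1 ^ 2 + x 2 ^ 2) ^ 2 * Real.log (2 + R ^ 2) ^ 2))) := by
            field_simp
            ring
        _ ≤ 1 * (C ^ 2 * (4 * (x 1 ^ 2 + x 2 ^ 2) /
              ((2 + x 1 ^ 2 + x 2 ^ 2) ^ 2 * (l / 7) ^ 2))) := by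
            gcongr
            linarith
        _ = _ := by
            field_simp
            ring

lemma cutoff_nonneg (R : ℝ) (x : EuclideanSpace ℝ (Fin 3)) : 0 ≤ cutoff R x :=
  mul_nonneg (Real.smoothTransition.nonneg _) (Real.smoothTransition.nonneg _)

lemma cutoff_le_one (R : ℝ) (x : EuclideanSpace ℝ (Fin 3)) : cutoff R x ≤ 1 :=
  mul_le_one₀ (Real.smoothTransition.le_one _) (Real.smoothTransition.nonneg _)
    (Real.smoothTransition.le_one _)

lemma hasCompactSupport_cutoff (R : ℝ) : HasCompactSupport (cutoff R) := by
  refine HasCompactSupport.intro (isCompact_closedBall (0 : EuclideanSpace ℝ (Fin 3))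
    √(2 * (2 + R ^ 2) ^ 8 + (2 + R ^ 2) ^ 2)) fun x hx => ?_
  by_contra h
  have h1 := lt_of_axial_ne_zero (left_ne_zero_of_mul h)
  have h2 := lt_sq_of_transverse_ne_zero (by positivity) (right_ne_zero_of_mul h)
  refine hx ?_
  rw [mem_closedBall_zero_iff]
  refine Real.le_sqrt_of_sq_le ?_
  rw [norm_sq_eq_three]
  linarith

lemma cutoff_eq_one {R : ℝ} {x : EuclideanSpace ℝ (Fin 3)} (h : ‖x‖ ≤ R) : cutoff R x = 1 := by
  have h1 : x 0 ^ 2 + x 1 ^ 2 + x 2 ^ 2 ≤ R ^ 2 := by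
    rw [← norm_sq_eq_three]
    exact pow_le_pow_left₀ (norm_nonneg x) h 2
  unfold cutoff
  rw [Real.smoothTransition.one_of_one_le, Real.smoothTransition.one_of_one_le, one_mul]
  · have h2 : Real.log (2 + x 1 ^ 2 + x 2 ^ 2) / Real.log (2 + R ^ 2) ≤ 1 := by
      rw [div_le_one (log_two_add_sq_pos R)]
      exact Real.log_le_log (by positivity) (by nlinarith [sq_nonneg (x 0)])
    linarith
  · have h2 : x 0 ^ 2 / (2 + R ^ 2) ^ 8 ≤ 1 := by
      rw [div_le_one (by positivity)]
      nlinarith [sq_le_pow_eight R, sq_nonneg (x 1), sq_nonneg (x 2)]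
    linarith

lemma support_fderiv_cutoff_subset (R : ℝ) :
    Function.support (fun x => fderiv ℝ (cutoff R) x) ⊆
      {x : EuclideanSpace ℝ (Fin 3) | R / √2 ≤ ‖x‖} := by
  intro x hx
  have h : ∃ i, fderiv ℝ (cutoff R) x (EuclideanSpace.single i 1) ≠ 0 := by
    by_contra! h
    refine hx (norm_eq_zero.1 (pow_eq_zero_iff two_ne_zero |>.1 ?_))
    rw [sum_sq_single_eq_norm_sq]
    simp [h]
  obtain ⟨i, hi⟩ := h
  exact le_norm_of_sq_le (by
    linarith [sq_le_of_fderiv_cutoff_ne_zero hi, sq_nonneg (x 0), sq_nonneg (x 1), sq_nonneg (x 2)])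

lemma volume_setOf_abs_le (r : Fin 3 → ℝ) :
    volume {x : EuclideanSpace ℝ (Fin 3) | ∀ i, |x i| ≤ r i} =
      ∏ i, ENNReal.ofReal (2 * r i) := by
  have h : {x : EuclideanSpace ℝ (Fin 3) | ∀ i, |x i| ≤ r i} =
      (WithLp.ofLp : EuclideanSpace ℝ (Fin 3) → Fin 3 → ℝ) ⁻¹'
        Set.pi Set.univ fun i => Set.Icc (-r i) (r i) := by
    ext x
    simp [abs_le, -Set.pi_univ_Icc]
  rw [h, (PiLp.volume_preserving_ofLp (Fin 3)).measure_preimage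
    (MeasurableSet.univ_pi fun i => measurableSet_Icc).nullMeasurableSet, volume_pi_pi]
  simp only [Real.volume_Icc]
  congr! 2
  ring

lemma eLpNorm_fderiv_cutoff_axial_le {C : ℝ} (hC0 : 0 < C)
    (hC : ∀ x, |deriv Real.smoothTransition x| ≤ C) (R : ℝ) :
    eLpNorm (fun x => fderiv ℝ (cutoff R) x (EuclideanSpace.single 0 1)) (3 / 2) volume ≤
      ENNReal.ofReal (48 * C) := by
  have hP : 0 < 2 + R ^ 2 := by positivity
  set P := 2 + R ^ 2 with hPdef
  set B := {x : EuclideanSpace ℝ (Fin 3) | ∀ i, |x i| ≤ ![2 * P ^ 4, P, P] i} with hB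
  have hvol : volume B = ENNReal.ofReal (16 * P ^ 6) := by
    rw [hB, volume_setOf_abs_le, Fin.prod_univ_three, ← ENNReal.ofReal_mul (by simp; positivity),
      ← ENNReal.ofReal_mul (by simp; positivity)]
    congr 1
    simp
    ring
  have hpt : ∀ x, ‖fderiv ℝ (cutoff R) x (EuclideanSpace.single 0 1)‖ ≤
      B.indicator (fun _ => 3 * C / P ^ 4) x := by
    intro x
    by_cases h : fderiv ℝ (cutoff R) x (EuclideanSpace.single 0 1) = 0
    · rw [h, norm_zero]
      exact Set.indicator_nonneg (fun _ _ => by positivity) x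
    · obtain ⟨-, h1, h2⟩ := sq_le_of_fderiv_cutoff_axial_ne_zero h
      rw [← hPdef] at h1 h2
      have hx : x ∈ B := by
        intro i
        fin_cases i
        · exact abs_le_of_sq_le_sq (by
            simp only [Fin.zero_eta, Matrix.cons_val_zero]
            nlinarith [pow_pos hP 8]) (by simp; positivity)
        · exact abs_le_of_sq_le_sq (by
            simp
            nlinarith [sq_nonneg (x 2)]) (by simp; positivity)
        · exact abs_le_of_sq_le_sq (by
            simp
            nlinarith [sq_nonneg (x 1)]) (by simp; positivity)
      rw [Set.indicator_of_mem hx, Real.norm_eq_abs]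
      refine abs_le_of_sq_le_sq ((fderiv_cutoff_axial_sq_le hC x).trans ?_) (by positivity)
      rw [← hPdef, div_pow, ← pow_mul]
      gcongr
      nlinarith [sq_nonneg C]
  refine (eLpNorm_mono_real hpt).trans ((eLpNorm_indicator_const_le _ _).trans ?_)
  have hexp : 1 / (3 / 2 : ENNReal).toReal = (2 / 3 : ℝ) := by
    rw [ENNReal.toReal_div]
    norm_num
  rw [hvol, hexp, Real.enorm_of_nonneg (by positivity),
    ENNReal.ofReal_rpow_of_pos (by positivity), ← ENNReal.ofReal_mul (by positivity)]
  refine ENNReal.ofReal_le_ofReal ?_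
  have h1 : (16 * P ^ 6) ^ (2 / 3 : ℝ) ≤ 16 * P ^ 4 := by
    rw [Real.mul_rpow (by norm_num) (by positivity), ← Real.rpow_natCast P 6, ← Real.rpow_mul hP.le,
      ← Real.rpow_natCast P 4]
    norm_num
    exact mul_le_mul_of_nonneg_right
      ((Real.rpow_le_rpow_of_exponent_le (by norm_num) (by norm_num)).trans_eq (Real.rpow_one 16))
      (by positivity)
  calc 3 * C / P ^ 4 * (16 * P ^ 6) ^ (2 / 3 : ℝ) ≤ 3 * C / P ^ 4 * (16 * P ^ 4) := by gcongr
    _ = 48 * C := by field_simp; ring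

/-- Existence of a family of cut-off functions `ψ_R` on `ℝ³` with `0 ≤ ψ_R ≤ 1`,
`ψ_R → 1` pointwise as `R → ∞`, whose `x₁`-derivative is bounded in `L^{3/2}` uniformly
in `R`, whose gradient is supported in `{‖x‖ ≥ R/√2}`, and satisfying the weighted
Poincaré-type estimate (v). -/
theorem stmt_5 :
    ∃ (ψ : ℝ → EuclideanSpace ℝ (Fin 3) → ℝ) (C₁ C₂ : ℝ), 0 < C₁ ∧ 0 < C₂ ∧
      (∀ x : EuclideanSpace ℝ (Fin 3),
        Tendsto (fun R : ℝ => ψ R x) atTop (nhds 1)) ∧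
      ∀ R : ℝ, 0 < R →
        (ContDiff ℝ (⊤ : ℕ∞) (ψ R) ∧ HasCompactSupport (ψ R) ∧
          ∀ x, 0 ≤ ψ R x ∧ ψ R x ≤ 1) ∧
        eLpNorm (fun x => fderiv ℝ (ψ R) x (EuclideanSpace.single 0 1)) (3 / 2) volume ≤
          ENNReal.ofReal C₁ ∧
        (Function.support (fun x => fderiv ℝ (ψ R) x) ⊆
          {x : EuclideanSpace ℝ (Fin 3) | R / Real.sqrt 2 ≤ ‖x‖}) ∧
        ∀ u : EuclideanSpace ℝ (Fin 3) → ℝ, ContDiff ℝ 1 u → HasCompactSupport u →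
          (∫ x, u x ^ 2 * ‖fderiv ℝ (ψ R) x‖ ^ 2) ≤
            C₂ ^ 2 * ∫ x in {x : EuclideanSpace ℝ (Fin 3) | R / Real.sqrt 2 ≤ ‖x‖},
              ‖fderiv ℝ u x‖ ^ 2 := by
  obtain ⟨C, hC0, hC⟩ := exists_abs_deriv_smoothTransition_le
  refine ⟨cutoff, 48 * C, √(196 * C ^ 2 * (4 * 8)), by positivity, by positivity, fun x => ?_,
    fun R hR => ⟨⟨contDiff_cutoff R, hasCompactSupport_cutoff R,
      fun x => ⟨cutoff_nonneg R x, cutoff_le_one R x⟩⟩, eLpNorm_fderiv_cutoff_axial_le hC0 hC R,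
      support_fderiv_cutoff_subset R, fun u hu hc => ?_⟩⟩
  · refine tendsto_const_nhds.congr' ?_
    filter_upwards [eventually_ge_atTop ‖x‖] with R hR
    exact (cutoff_eq_one hR).symm
  · rw [Real.sq_sqrt (by positivity)]
    refine integral_sq_mul_le_of_le_divergence (F := hardyField R) (by norm_num) (by positivity)
      (measurableSet_le measurable_const measurable_norm) (contDiff_hardyField R)
      (fun i x hx => hardyField_eq_zero hR i hx)
      (((contDiff_cutoff R (n := 1)).continuous_fderiv one_ne_zero).norm.pow 2)
      (fun x => ?_) (fun x => ?_) hu hc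
    · obtain ⟨h1, h2⟩ := hardyField_divergence_bounds R x
      linarith
    · exact (norm_fderiv_cutoff_sq_le hR hC x).trans
        (mul_le_mul_of_nonneg_left (hardyField_divergence_bounds R x).1 (by positivity))
end
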